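/- arXiv:1107.5073 — 2 statements merged into one kernel-verified Lean document; each statement's English description precedes it below -/
import Mathlib

section
/- Let (B_1,B_2,a,b) be a handsaw quiver datum satisfying the moment map equation μ = 0. Then (B_1,B_2,a,b) is costable if and only if ker(α_i|_z) ∩ ker(β_i) = 0 for every 1 ≤ i ≤ n−1 and every z ∈ ℂ. -/
noncomputable section

open LinearMap Module

/-- The chain `B_{1,i-1} ∘ ⋯ ∘ B_{1,j} ∘ a_j : W_j → V_i` (zero/junk when out of range). -/
def AtoV {V W : ℕ → Type*}
    [∀ i, AddCommGroup (V i)] [∀ i, Module ℂ (V i)]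
    [∀ i, AddCommGroup (W i)] [∀ i, Module ℂ (W i)]
    (B1 : ∀ i, V i →ₗ[ℂ] V (i + 1)) (a : ∀ i, W i →ₗ[ℂ] V i) :
    (i j : ℕ) → (W j →ₗ[ℂ] V i)
  | 0, _ => 0
  | i + 1, j =>
    if h : j = i + 1 then cast (by rw [h]) (a j)
    else (B1 i) ∘ₗ (AtoV B1 a i j)

/-- The map `α_i|_z : W_1 ⊕ ⋯ ⊕ W_i ⊕ V_i → V_i`, whose restriction to `W_j` (`j ≤ i`) is
`B_{1,i-1} ∘ ⋯ ∘ B_{1,j} ∘ a_j` and whose restriction to `V_i` is `z·id − B_{2,i}`. -/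
def alphaMap {V W : ℕ → Type*}
    [∀ i, AddCommGroup (V i)] [∀ i, Module ℂ (V i)]
    [∀ i, AddCommGroup (W i)] [∀ i, Module ℂ (W i)]
    (B1 : ∀ i, V i →ₗ[ℂ] V (i + 1)) (B2 : ∀ i, V i →ₗ[ℂ] V i)
    (a : ∀ i, W i →ₗ[ℂ] V i) (i : ℕ) (z : ℂ) :
    ((∀ j : Fin i, W (j.val + 1)) × V i) →ₗ[ℂ] V i :=
  LinearMap.coprod
    (∑ j : Fin i, (AtoV B1 a i (j.val + 1)) ∘ₗ (LinearMap.proj j))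
    (z • LinearMap.id - B2 i)

/-- The map `β_i : W_1 ⊕ ⋯ ⊕ W_i ⊕ V_i → W_1 ⊕ ⋯ ⊕ W_{i+1} ⊕ V_{i+1}`, the identity on each
`W_j` (`j ≤ i`) and `(b_i, B_{1,i})` on `V_i`. -/
def betaMap {V W : ℕ → Type*}
    [∀ i, AddCommGroup (V i)] [∀ i, Module ℂ (V i)]
    [∀ i, AddCommGroup (W i)] [∀ i, Module ℂ (W i)]
    (B1 : ∀ i, V i →ₗ[ℂ] V (i + 1)) (b : ∀ i, V i →ₗ[ℂ] W (i + 1)) (i : ℕ) :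
    ((∀ j : Fin i, W (j.val + 1)) × V i) →ₗ[ℂ]
      ((∀ j : Fin (i + 1), W (j.val + 1)) × V (i + 1)) :=
  LinearMap.prod
    (LinearMap.pi fun j' : Fin (i + 1) =>
      if h : j'.val < i then
        (LinearMap.proj (⟨j'.val, h⟩ : Fin i)) ∘ₗ (LinearMap.fst ℂ _ _)
      else
        cast (by
          have hj : j'.val = i := le_antisymm (Nat.lt_succ_iff.mp j'.isLt) (not_lt.mp h)
          rw [hj]) ((b i) ∘ₗ (LinearMap.snd ℂ (∀ j : Fin i, W (j.val + 1)) (V i))))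
    ((B1 i) ∘ₗ (LinearMap.snd ℂ _ _))

/-- The moment map equation μ = 0. -/
def MomentZero {V W : ℕ → Type*}
    [∀ i, AddCommGroup (V i)] [∀ i, Module ℂ (V i)]
    [∀ i, AddCommGroup (W i)] [∀ i, Module ℂ (W i)]
    (n : ℕ)
    (B1 : ∀ i, V i →ₗ[ℂ] V (i + 1)) (B2 : ∀ i, V i →ₗ[ℂ] V i)
    (a : ∀ i, W i →ₗ[ℂ] V i) (b : ∀ i, V i →ₗ[ℂ] W (i + 1)) : Prop :=
  ∀ i, 1 ≤ i → i ≤ n - 2 →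
    (B1 i) ∘ₗ (B2 i) - (B2 (i + 1)) ∘ₗ (B1 i) + (a (i + 1)) ∘ₗ (b i) = 0

/-- Stability of a handsaw quiver datum. -/
def IsStable {V W : ℕ → Type*}
    [∀ i, AddCommGroup (V i)] [∀ i, Module ℂ (V i)]
    [∀ i, AddCommGroup (W i)] [∀ i, Module ℂ (W i)]
    (n : ℕ)
    (B1 : ∀ i, V i →ₗ[ℂ] V (i + 1)) (B2 : ∀ i, V i →ₗ[ℂ] V i)
    (a : ∀ i, W i →ₗ[ℂ] V i) : Prop :=
  ∀ S : ∀ i, Submodule ℂ (V i),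
    (∀ i, 1 ≤ i → i ≤ n - 2 → (S i).map (B1 i) ≤ S (i + 1)) →
    (∀ i, 1 ≤ i → i ≤ n - 1 → (S i).map (B2 i) ≤ S i) →
    (∀ i, 1 ≤ i → i ≤ n - 1 → LinearMap.range (a i) ≤ S i) →
    ∀ i, 1 ≤ i → i ≤ n - 1 → S i = ⊤

/-- Costability of a handsaw quiver datum. -/
def IsCostable {V W : ℕ → Type*}
    [∀ i, AddCommGroup (V i)] [∀ i, Module ℂ (V i)]
    [∀ i, AddCommGroup (W i)] [∀ i, Module ℂ (W i)]
    (n : ℕ)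
    (B1 : ∀ i, V i →ₗ[ℂ] V (i + 1)) (B2 : ∀ i, V i →ₗ[ℂ] V i)
    (b : ∀ i, V i →ₗ[ℂ] W (i + 1)) : Prop :=
  ∀ S : ∀ i, Submodule ℂ (V i),
    (∀ i, 1 ≤ i → i ≤ n - 2 → (S i).map (B1 i) ≤ S (i + 1)) →
    (∀ i, 1 ≤ i → i ≤ n - 1 → (S i).map (B2 i) ≤ S i) →
    (∀ i, 1 ≤ i → i ≤ n - 1 → S i ≤ LinearMap.ker (b i)) →
    ∀ i, 1 ≤ i → i ≤ n - 1 → S i = ⊥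

theorem mem_kers_iff {V W : ℕ → Type*}
    [∀ i, AddCommGroup (V i)] [∀ i, Module ℂ (V i)]
    [∀ i, AddCommGroup (W i)] [∀ i, Module ℂ (W i)]
    (B1 : ∀ i, V i →ₗ[ℂ] V (i + 1)) (B2 : ∀ i, V i →ₗ[ℂ] V i)
    (a : ∀ i, W i →ₗ[ℂ] V i) (b : ∀ i, V i →ₗ[ℂ] W (i + 1)) (i : ℕ) (z : ℂ)
    (w : ∀ j : Fin i, W (j.val + 1)) (v : V i) :
    (w, v) ∈ LinearMap.ker (alphaMap B1 B2 a i z) ⊓ LinearMap.ker (betaMap B1 b i) ↔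
      w = 0 ∧ b i v = 0 ∧ B1 i v = 0 ∧ B2 i v = z • v := by
  have hbeta : (w, v) ∈ LinearMap.ker (betaMap B1 b i) ↔ w = 0 ∧ b i v = 0 ∧ B1 i v = 0 := by
    rw [LinearMap.mem_ker, betaMap, Prod.ext_iff, ← and_assoc]
    refine and_congr ?_ (by simp)
    constructor
    · intro h
      constructor
      · funext j
        have := congrFun h ⟨j.val, by omega⟩
        simpa using this
      · have := congrFun h ⟨i, by omega⟩
        simpa using this
    · rintro ⟨rfl, hb⟩
      funext ⟨j, hj⟩
      rcases Nat.lt_succ_iff_lt_or_eq.mp hj with h | h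
      · simp [h]
      · subst h
        simp [hb]
  rw [Submodule.mem_inf, hbeta, LinearMap.mem_ker, alphaMap, LinearMap.coprod_apply]
  constructor
  · rintro ⟨h, rfl, hb, h1⟩
    refine ⟨rfl, hb, h1, ?_⟩
    simp [sub_eq_zero] at h
    exact h.symm
  · rintro ⟨rfl, hb, h1, h2⟩
    refine ⟨?_, rfl, hb, h1⟩
    simp [h2]

theorem costable_iff_ker_alpha_inter_ker_beta_eq_bot (n : ℕ) (hn : 2 ≤ n) (V W : ℕ → Type*)
    [∀ i, AddCommGroup (V i)] [∀ i, Module ℂ (V i)] [∀ i, FiniteDimensional ℂ (V i)]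
    [∀ i, AddCommGroup (W i)] [∀ i, Module ℂ (W i)] [∀ i, FiniteDimensional ℂ (W i)]
    (B1 : ∀ i, V i →ₗ[ℂ] V (i + 1)) (B2 : ∀ i, V i →ₗ[ℂ] V i)
    (a : ∀ i, W i →ₗ[ℂ] V i) (b : ∀ i, V i →ₗ[ℂ] W (i + 1))
    [Subsingleton (V n)]
    (hmu : MomentZero n B1 B2 a b) :
    IsCostable n B1 B2 b ↔
      ∀ i, 1 ≤ i → i ≤ n - 1 → ∀ z : ℂ,
        LinearMap.ker (alphaMap B1 B2 a i z) ⊓ LinearMap.ker (betaMap B1 b i) = ⊥ := by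
  constructor
  · intro hc i hi hin z
    have key := hc (fun j => LinearMap.ker (b j) ⊓ LinearMap.ker (B1 j) ⊓
        LinearMap.ker (B2 j - z • LinearMap.id)) ?_ ?_ ?_ i hi hin
    · rw [eq_bot_iff]
      rintro ⟨w, v⟩ h
      rw [mem_kers_iff] at h
      obtain ⟨rfl, hb, h1, h2⟩ := h
      have hv : v ∈ (⊥ : Submodule ℂ (V i)) := by
        rw [← key]
        simp [hb, h1, h2]
      rw [Submodule.mem_bot] at hv
      simp [hv]
    · rintro j - - _ ⟨x, ⟨⟨_, hx⟩, _⟩, rfl⟩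
      have hx : B1 j x = 0 := hx
      rw [hx]
      exact zero_mem _
    · rintro j - - _ ⟨x, hx, rfl⟩
      have h2 : B2 j x = z • x := by
        have := hx.2
        simpa [sub_eq_zero] using this
      rw [h2]
      exact Submodule.smul_mem _ _ hx
    · rintro j - - x ⟨⟨hx, _⟩, _⟩
      exact hx
  · intro H S hS1 hS2 hSb
    have step : ∀ i, 1 ≤ i → i ≤ n - 1 → (∀ x ∈ S i, B1 i x = 0) → S i = ⊥ := by
      intro i hi hin h1
      by_contra hne
      have : Nontrivial (S i) := Submodule.nontrivial_iff_ne_bot.mpr hne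
      have hmap : ∀ x ∈ S i, B2 i x ∈ S i := fun x hx => hS2 i hi hin ⟨x, hx, rfl⟩
      obtain ⟨z, hz⟩ := Module.End.exists_eigenvalue ((B2 i).restrict hmap)
      obtain ⟨⟨v, hv⟩, hev, hv0⟩ := hz.exists_hasEigenvector
      rw [Module.End.mem_eigenspace_iff] at hev
      have hev2 : B2 i v = z • v := congrArg Subtype.val hev
      have hmem := (mem_kers_iff B1 B2 a b i z 0 v).mpr
        ⟨rfl, hSb i hi hin hv, h1 v hv, hev2⟩
      rw [H i hi hin z, Submodule.mem_bot, Prod.mk_eq_zero] at hmem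
      exact hv0 (Subtype.ext hmem.2)
    have main : ∀ k i, 1 ≤ i → i + k = n - 1 → S i = ⊥ := by
      intro k
      induction k with
      | zero =>
        intro i hi hk
        refine step i hi (by omega) fun x _ => ?_
        have hn' : n = i + 1 := by omega
        subst hn'
        exact Subsingleton.elim _ _
      | succ k ih =>
        intro i hi hk
        refine step i hi (by omega) fun x hx => ?_
        have h : B1 i x ∈ S (i + 1) := hS1 i hi (by omega) ⟨x, hx, rfl⟩
        rw [ih (i + 1) (by omega) (by omega)] at h
        simpa using h
    intro i hi hin
    exact main (n - 1 - i) i hi (by omega)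

end
end

section
/- Let (B_1,B_2,a,b) be a handsaw quiver datum on (V,W). Define the transposed datum (B'_1,B'_2,a',b') on the dual graded spaces V'_i = (V_{n−i})^* (1 ≤ i ≤ n−1) and W'_j = (W_{n+1−j})^* (1 ≤ j ≤ n) by B'_{1,i} = (B_{1,n−1−i})^t : V'_i → V'_{i+1}, B'_{2,i} = (B_{2,n−i})^t : V'_i → V'_i, a'_i = (b_{n−i})^t : W'_i → V'_i, and b'_i = (a_{n−i})^t : V'_i → W'_{i+1}, where f^t denotes the transpose (dual) of a linear map f. Then (B_1,B_2,a,b) is stable if and only if (B'_1,B'_2,a',b') is costable, and (B_1,B_2,a,b) is costable if and only if (B'_1,B'_2,a',b') is stable. -/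
noncomputable section

open LinearMap Module

/-- Identification of the fibers of a graded vector space along an equality of indices. -/
def castLin {V : ℕ → Type*} [∀ i, AddCommGroup (V i)] [∀ i, Module ℂ (V i)]
    {i j : ℕ} (h : i = j) : V i →ₗ[ℂ] V j := by
  subst h; exact LinearMap.id

theorem castLin_refl {V : ℕ → Type*} [∀ i, AddCommGroup (V i)] [∀ i, Module ℂ (V i)]
    {i : ℕ} (h : i = i) (v : V i) : castLin (V := V) h v = v := rfl

theorem castLin_mem {V : ℕ → Type*} [∀ i, AddCommGroup (V i)] [∀ i, Module ℂ (V i)]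
    (S : ∀ i, Submodule ℂ (V i)) {i j : ℕ} (h : i = j) (v : V i) :
    castLin (V := V) h v ∈ S j ↔ v ∈ S i := by
  subst h; rfl

theorem castLin_eq_zero {V : ℕ → Type*} [∀ i, AddCommGroup (V i)] [∀ i, Module ℂ (V i)]
    {i j : ℕ} (h : i = j) (v : V i) : castLin (V := V) h v = 0 ↔ v = 0 := by
  subst h; rfl

theorem castLin_surj {V : ℕ → Type*} [∀ i, AddCommGroup (V i)] [∀ i, Module ℂ (V i)]
    {i j : ℕ} (h : i = j) (w : V j) : ∃ v, castLin (V := V) h v = w := by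
  subst h; exact ⟨w, rfl⟩

/-- The graded coannihilator of a graded subspace of the dual. -/
def coann (n : ℕ) {V : ℕ → Type*} [∀ i, AddCommGroup (V i)] [∀ i, Module ℂ (V i)]
    (S : ∀ i, Submodule ℂ (Module.Dual ℂ (V (n - i)))) (j : ℕ) : Submodule ℂ (V j) where
  carrier := {v | ∀ i (h : j = n - i), 1 ≤ i → i ≤ n - 1 →
    ∀ φ ∈ S i, φ (castLin (V := V) h v) = 0}
  zero_mem' := by intro i h _ _ φ _; simp
  add_mem' := by
    intro x y hx hy i h h1 h2 φ hφ
    rw [map_add, map_add, hx i h h1 h2 φ hφ, hy i h h1 h2 φ hφ, add_zero]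
  smul_mem' := by
    intro c x hx i h h1 h2 φ hφ
    rw [map_smul, map_smul, hx i h h1 h2 φ hφ, smul_zero]

theorem coann_eq (n : ℕ) {V : ℕ → Type*} [∀ i, AddCommGroup (V i)] [∀ i, Module ℂ (V i)]
    (S : ∀ i, Submodule ℂ (Module.Dual ℂ (V (n - i)))) (i : ℕ) (h1 : 1 ≤ i) (h2 : i ≤ n - 1) :
    coann n S (n - i) = (S i).dualCoannihilator := by
  ext v
  rw [Submodule.mem_dualCoannihilator]
  constructor
  · intro h φ hφ
    exact h i rfl h1 h2 φ hφ
  · intro h k hk hk1 hk2 φ hφ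
    obtain rfl : i = k := by omega
    exact h φ hφ

theorem stable_iff_transpose_costable (n : ℕ) (hn : 2 ≤ n) (V W : ℕ → Type*)
    [∀ i, AddCommGroup (V i)] [∀ i, Module ℂ (V i)] [∀ i, FiniteDimensional ℂ (V i)]
    [∀ i, AddCommGroup (W i)] [∀ i, Module ℂ (W i)] [∀ i, FiniteDimensional ℂ (W i)]
    (B1 : ∀ i, V i →ₗ[ℂ] V (i + 1)) (B2 : ∀ i, V i →ₗ[ℂ] V i)
    (a : ∀ i, W i →ₗ[ℂ] V i) (b : ∀ i, V i →ₗ[ℂ] W (i + 1))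
    -- the transposed datum on the dual graded spaces V'_i = (V_{n-i})*, W'_j = (W_{n+1-j})*
    (B1' : ∀ i, Module.Dual ℂ (V (n - i)) →ₗ[ℂ] Module.Dual ℂ (V (n - (i + 1))))
    (B2' : ∀ i, Module.Dual ℂ (V (n - i)) →ₗ[ℂ] Module.Dual ℂ (V (n - i)))
    (a' : ∀ i, Module.Dual ℂ (W (n + 1 - i)) →ₗ[ℂ] Module.Dual ℂ (V (n - i)))
    (b' : ∀ i, Module.Dual ℂ (V (n - i)) →ₗ[ℂ] Module.Dual ℂ (W (n + 1 - (i + 1))))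
    -- B'_{1,i} = (B_{1,n-1-i})^t
    (hB1' : ∀ i, (hi1 : 1 ≤ i) → (hi2 : i ≤ n - 2) →
      ∀ (φ : Module.Dual ℂ (V (n - i))) (v : V (n - (i + 1))),
        B1' i φ v = φ (castLin (V := V) (by omega : n - (i + 1) + 1 = n - i)
          (B1 (n - (i + 1)) v)))
    -- B'_{2,i} = (B_{2,n-i})^t
    (hB2' : ∀ i, 1 ≤ i → i ≤ n - 1 → B2' i = (B2 (n - i)).dualMap)
    -- a'_i = (b_{n-i})^t
    (ha' : ∀ i, (hi1 : 1 ≤ i) → (hi2 : i ≤ n - 1) →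
      ∀ (ψ : Module.Dual ℂ (W (n + 1 - i))) (v : V (n - i)),
        a' i ψ v = ψ (castLin (V := W) (by omega : n - i + 1 = n + 1 - i) (b (n - i) v)))
    -- b'_i = (a_{n-i})^t
    (hb' : ∀ i, (hi1 : 1 ≤ i) → (hi2 : i ≤ n - 1) →
      ∀ (φ : Module.Dual ℂ (V (n - i))) (w : W (n + 1 - (i + 1))),
        b' i φ w = φ (a (n - i) (castLin (V := W) (by omega : n + 1 - (i + 1) = n - i) w))) :
    (IsStable n B1 B2 a ↔
      IsCostable (V := fun i => Module.Dual ℂ (V (n - i)))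
        (W := fun j => Module.Dual ℂ (W (n + 1 - j))) n B1' B2' b') ∧
    (IsCostable n B1 B2 b ↔
      IsStable (V := fun i => Module.Dual ℂ (V (n - i)))
        (W := fun j => Module.Dual ℂ (W (n + 1 - j))) n B1' B2' a') := by
  have mB1 : ∀ S' : ∀ i, Submodule ℂ (Module.Dual ℂ (V (n - i))),
      (∀ i, 1 ≤ i → i ≤ n - 2 → (S' i).map (B1' i) ≤ S' (i + 1)) →
      ∀ i, 1 ≤ i → i ≤ n - 2 → (coann n S' i).map (B1 i) ≤ coann n S' (i + 1) := by
    intro S' h j hj1 hj2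
    obtain ⟨i, rfl⟩ : ∃ i, j = n - (i + 1) := ⟨n - 1 - j, by omega⟩
    rintro _ ⟨v, hv, rfl⟩
    have hi1 : 1 ≤ i := by omega
    have hi2 : i ≤ n - 2 := by omega
    rw [← castLin_mem (coann n S') (by omega : n - (i + 1) + 1 = n - i),
      coann_eq n S' i hi1 (by omega), Submodule.mem_dualCoannihilator]
    intro φ hφ
    rw [← hB1' i hi1 hi2]
    rw [coann_eq n S' (i + 1) (by omega) (by omega)] at hv
    exact (Submodule.mem_dualCoannihilator _).1 hv _ (h i hi1 hi2 ⟨φ, hφ, rfl⟩)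
  have mB2 : ∀ S' : ∀ i, Submodule ℂ (Module.Dual ℂ (V (n - i))),
      (∀ i, 1 ≤ i → i ≤ n - 1 → (S' i).map (B2' i) ≤ S' i) →
      ∀ i, 1 ≤ i → i ≤ n - 1 → (coann n S' i).map (B2 i) ≤ coann n S' i := by
    intro S' h j hj1 hj2
    obtain ⟨i, rfl⟩ : ∃ i, j = n - i := ⟨n - j, by omega⟩
    rintro _ ⟨v, hv, rfl⟩
    have hi1 : 1 ≤ i := by omega
    have hi2 : i ≤ n - 1 := by omega
    rw [coann_eq n S' i hi1 hi2] at hv ⊢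
    rw [Submodule.mem_dualCoannihilator]
    intro φ hφ
    have := (Submodule.mem_dualCoannihilator _).1 hv _ (h i hi1 hi2 ⟨φ, hφ, rfl⟩)
    rwa [hB2' i hi1 hi2] at this
  have nB1 : ∀ S : ∀ i, Submodule ℂ (V i),
      (∀ i, 1 ≤ i → i ≤ n - 2 → (S i).map (B1 i) ≤ S (i + 1)) →
      ∀ i, 1 ≤ i → i ≤ n - 2 → ((S (n - i)).dualAnnihilator).map (B1' i) ≤
        (S (n - (i + 1))).dualAnnihilator := by
    rintro S h i hi1 hi2 _ ⟨φ, hφ, rfl⟩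
    rw [Submodule.mem_dualAnnihilator]
    intro v hv
    rw [hB1' i hi1 hi2]
    exact (Submodule.mem_dualAnnihilator _).1 hφ _
      ((castLin_mem S _ _).2 (h (n - (i + 1)) (by omega) (by omega) ⟨v, hv, rfl⟩))
  have nB2 : ∀ S : ∀ i, Submodule ℂ (V i),
      (∀ i, 1 ≤ i → i ≤ n - 1 → (S i).map (B2 i) ≤ S i) →
      ∀ i, 1 ≤ i → i ≤ n - 1 → ((S (n - i)).dualAnnihilator).map (B2' i) ≤
        (S (n - i)).dualAnnihilator := by
    rintro S h i hi1 hi2 _ ⟨φ, hφ, rfl⟩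
    rw [Submodule.mem_dualAnnihilator]
    intro v hv
    rw [hB2' i hi1 hi2]
    exact (Submodule.mem_dualAnnihilator _).1 hφ _
      (h (n - i) (by omega) (by omega) ⟨v, hv, rfl⟩)
  refine ⟨⟨?_, ?_⟩, ⟨?_, ?_⟩⟩
  · intro hs S' h1 h2 h3 i hi1 hi2
    have key := hs (coann n S') (mB1 S' h1) (mB2 S' h2) (by
      intro j hj1 hj2
      obtain ⟨i, rfl⟩ : ∃ i, j = n - i := ⟨n - j, by omega⟩
      rintro _ ⟨w, rfl⟩
      have hi1 : 1 ≤ i := by omega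
      have hi2 : i ≤ n - 1 := by omega
      rw [coann_eq n S' i hi1 hi2, Submodule.mem_dualCoannihilator]
      intro φ hφ
      obtain ⟨w, rfl⟩ := castLin_surj (V := W) (by omega : n + 1 - (i + 1) = n - i) w
      rw [← hb' i hi1 hi2]
      have h0 : b' i φ = 0 := h3 i hi1 hi2 hφ
      rw [h0]; rfl) (n - i) (by omega) (by omega)
    rw [coann_eq n S' i hi1 hi2] at key
    rw [eq_bot_iff]
    intro φ hφ
    rw [Submodule.mem_bot]
    ext v
    have hv : v ∈ (S' i).dualCoannihilator := by rw [key]; trivial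
    exact (Submodule.mem_dualCoannihilator _).1 hv φ hφ
  · intro hs S h1 h2 h3 j hj1 hj2
    have key := hs (fun i => (S (n - i)).dualAnnihilator) (nB1 S h1) (nB2 S h2) (by
      intro i hi1 hi2 φ hφ
      rw [LinearMap.mem_ker]
      ext w
      rw [hb' i hi1 hi2]
      exact (Submodule.mem_dualAnnihilator _).1 hφ _
        (h3 (n - i) (by omega) (by omega) ⟨_, rfl⟩))
    obtain ⟨i, rfl⟩ : ∃ i, j = n - i := ⟨n - j, by omega⟩
    have k := key i (by omega) (by omega)
    have k2 : (S (n - i)).dualAnnihilator = ⊥ := k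
    rw [← Subspace.dualAnnihilator_dualCoannihilator_eq (W := S (n - i)), k2,
      Submodule.dualCoannihilator_bot]
  · intro hs S' h1 h2 h3 i hi1 hi2
    have key := hs (coann n S') (mB1 S' h1) (mB2 S' h2) (by
      intro j hj1 hj2
      obtain ⟨i, rfl⟩ : ∃ i, j = n - i := ⟨n - j, by omega⟩
      intro v hv
      have hi1 : 1 ≤ i := by omega
      have hi2 : i ≤ n - 1 := by omega
      rw [coann_eq n S' i hi1 hi2] at hv
      rw [LinearMap.mem_ker,
        ← castLin_eq_zero (V := W) (by omega : n - i + 1 = n + 1 - i),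
        ← Module.forall_dual_apply_eq_zero_iff ℂ]
      intro ψ
      rw [← ha' i hi1 hi2]
      exact (Submodule.mem_dualCoannihilator _).1 hv _ (h3 i hi1 hi2 ⟨ψ, rfl⟩))
      (n - i) (by omega) (by omega)
    rw [coann_eq n S' i hi1 hi2] at key
    have e := Subspace.dualCoannihilator_dualAnnihilator_eq (W := S' i)
    rw [key, Submodule.dualAnnihilator_bot] at e
    exact e.symm
  · intro hs S h1 h2 h3 j hj1 hj2
    have key := hs (fun i => (S (n - i)).dualAnnihilator) (nB1 S h1) (nB2 S h2) (by
      rintro i hi1 hi2 _ ⟨ψ, rfl⟩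
      rw [Submodule.mem_dualAnnihilator]
      intro v hv
      have h0 : b (n - i) v = 0 := h3 (n - i) (by omega) (by omega) hv
      rw [ha' i hi1 hi2, h0, map_zero, map_zero])
    obtain ⟨i, rfl⟩ : ∃ i, j = n - i := ⟨n - j, by omega⟩
    have k2 : (S (n - i)).dualAnnihilator = ⊤ := key i (by omega) (by omega)
    rw [← Subspace.dualAnnihilator_dualCoannihilator_eq (W := S (n - i)), k2, eq_bot_iff]
    intro v hv
    rw [Submodule.mem_bot, ← Module.forall_dual_apply_eq_zero_iff ℂ]
    intro φ
    exact (Submodule.mem_dualCoannihilator _).1 hv φ trivial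

end
end
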